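/- arXiv:2008.10133 — 2 statements merged into one kernel-verified Lean document; each statement's English description precedes it below -/
import Mathlib

section
/- Let n ≥ 2, let α₁,…,α_n be a basis of ℂ^n, fix k ∈ {1,…,n}, and let p¹,…,p^{n−1} be polynomials in n variables over ℂ. Let β, γ ∈ ℂ^n be linearly independent vectors with (β,β) ≠ 0 and (γ,γ) ≠ 0, and suppose each pⁱ is invariant under both reflections s_β and s_γ. Then the determinant J_k(x) := det((∂_{α_j} pⁱ)(x))_{1≤i≤n−1, j≠k} vanishes at every point x ∈ ℂ^n with (β,x) = 0 and (γ,x) = 0. -/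
open MvPolynomial

/-- The standard bilinear form `(u,v) = ∑ i, uᵢ vᵢ` on `ℂ^n`. -/
noncomputable def bform {n : ℕ} (u v : Fin n → ℂ) : ℂ := ∑ i, u i * v i

/-- The directional derivative `∂_v p = ∑ i, vᵢ ∂p/∂xᵢ` of a polynomial in `n` variables. -/
noncomputable def dirDeriv {n : ℕ} (v : Fin n → ℂ) (p : MvPolynomial (Fin n) ℂ) :
    MvPolynomial (Fin n) ℂ :=
  ∑ i, MvPolynomial.C (v i) * MvPolynomial.pderiv i p

/-- The reflection `s_α(x) = x − (2(α,x)/(α,α))·α` in the hyperplane orthogonal to `α`. -/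
noncomputable def reflect {n : ℕ} (α x : Fin n → ℂ) : Fin n → ℂ :=
  fun i => x i - (2 * bform α x / bform α α) * α i

theorem eval_dirDeriv {n : ℕ} (v x : Fin n → ℂ) (p : MvPolynomial (Fin n) ℂ) :
    eval x (dirDeriv v p) = ∑ i, v i * eval x (pderiv i p) := by
  simp [dirDeriv]

/-- The directional derivative is linear in the direction. -/
theorem eval_dirDeriv_sum_smul {n : ℕ} {ι : Type*} (s : Finset ι) (c : ι → ℂ)
    (v : ι → Fin n → ℂ) (x : Fin n → ℂ) (p : MvPolynomial (Fin n) ℂ) :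
    eval x (dirDeriv (∑ j ∈ s, c j • v j) p) = ∑ j ∈ s, c j * eval x (dirDeriv (v j) p) := by
  simp only [eval_dirDeriv, Finset.sum_apply, Pi.smul_apply, smul_eq_mul, Finset.sum_mul,
    Finset.mul_sum]
  rw [Finset.sum_comm]
  simp only [mul_assoc]

theorem hasDerivAt_eval_line {n : ℕ} (v x : Fin n → ℂ) (p : MvPolynomial (Fin n) ℂ) :
    HasDerivAt (fun t : ℂ => eval (x + t • v) p) (eval x (dirDeriv v p)) 0 := by
  rw [eval_dirDeriv]
  induction p using MvPolynomial.induction_on with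
  | C a => simpa using hasDerivAt_const (0 : ℂ) a
  | add p q hp hq =>
    simp only [map_add, mul_add, Finset.sum_add_distrib]
    exact hp.add hq
  | mul_X p j hp =>
    have hX : HasDerivAt (fun t : ℂ => x j + t * v j) (v j) 0 := by
      simpa using ((hasDerivAt_id (0 : ℂ)).mul_const (v j)).const_add (x j)
    have h := hp.mul hX
    simp only [map_mul, eval_X, Pi.add_apply, Pi.smul_apply, smul_eq_mul]
    refine h.congr_deriv ?_
    simp only [zero_smul, add_zero, zero_mul, Derivation.leibniz, pderiv_X, smul_eq_mul, map_add,
      map_mul, eval_X, mul_add, Finset.sum_add_distrib, Finset.sum_mul]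
    rw [add_comm]
    congr 1
    · rw [Finset.sum_eq_single j]
      · simp [mul_comm]
      · intro i _ hij
        simp [hij.symm]
      · simp
    · exact Finset.sum_congr rfl fun i _ => by ring

theorem reflect_add_smul {n : ℕ} {β x : Fin n → ℂ} (hβ : bform β β ≠ 0) (hx : bform β x = 0)
    (t : ℂ) : reflect β (x + t • β) = x + (-t) • β := by
  have h : bform β (x + t • β) = t * bform β β := by
    have : bform β (x + t • β) = bform β x + t * bform β β := by
      simp only [bform, Pi.add_apply, Pi.smul_apply, smul_eq_mul, mul_add,
        Finset.sum_add_distrib, Finset.mul_sum]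
      congr 1
      exact Finset.sum_congr rfl fun i _ => by ring
    rw [this, hx, zero_add]
  ext i
  simp only [reflect, h, Pi.add_apply, Pi.smul_apply, smul_eq_mul]
  field_simp
  ring

/-- The normal derivative of a reflection-invariant polynomial vanishes on the mirror. -/
theorem eval_dirDeriv_eq_zero_of_reflect_invariant {n : ℕ} {β x : Fin n → ℂ}
    {p : MvPolynomial (Fin n) ℂ} (hβ : bform β β ≠ 0) (hx : bform β x = 0)
    (hinv : ∀ y, eval (reflect β y) p = eval y p) : eval x (dirDeriv β p) = 0 := by
  have h := hasDerivAt_eval_line β x p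
  have h' : HasDerivAt (fun t : ℂ => eval (x + t • β) p) (-eval x (dirDeriv β p)) 0 := by
    have hneg := HasDerivAt.comp_of_eq (0 : ℂ) h (hasDerivAt_neg (0 : ℂ)) neg_zero.symm
    rw [mul_neg_one] at hneg
    refine hneg.congr_of_eventuallyEq (Filter.Eventually.of_forall fun t => ?_)
    simp only [Function.comp_apply]
    rw [← reflect_add_smul hβ hx, hinv]
  exact self_eq_neg.mp (h.unique h')

/-- A linear functional vanishes on some nonzero combination of two independent vectors. -/
theorem exists_combination_ne_zero_of_linearIndependent {V : Type*} [AddCommGroup V] [Module ℂ V]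
    {β γ : V} (h : LinearIndependent ℂ ![β, γ]) (f : V →ₗ[ℂ] ℂ) :
    ∃ a b : ℂ, a • β + b • γ ≠ 0 ∧ f (a • β + b • γ) = 0 := by
  rw [LinearIndependent.pair_iff] at h
  by_cases hβ : f β = 0
  · refine ⟨1, 0, fun h0 => one_ne_zero (h 1 0 h0).1, by simp [hβ]⟩
  · refine ⟨f γ, -f β, fun h0 => hβ (neg_eq_zero.mp (h _ _ h0).2), ?_⟩
    simp only [map_add, map_smul, smul_eq_mul]
    ring

/- Here the number of variables of the natural-language statement is `n + 1` (so that the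
hypothesis `n ≥ 2` there becomes `1 ≤ n`), the basis consists of `αv 0, …, αv n`, and the
`(n-1) × (n-1)` matrix defining `J_k` has rows indexed by `i : Fin n` and columns indexed by
`j ∈ {0,…,n} \ {k}` in increasing order via `k.succAbove`. -/
theorem stmt15 (n : ℕ) (hn : 1 ≤ n)
    (αv : Fin (n + 1) → (Fin (n + 1) → ℂ))
    (hli : LinearIndependent ℂ αv)
    (hsp : Submodule.span ℂ (Set.range αv) = ⊤)
    (k : Fin (n + 1))
    (p : Fin n → MvPolynomial (Fin (n + 1)) ℂ)
    (β γ : Fin (n + 1) → ℂ) (hβγ : LinearIndependent ℂ ![β, γ])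
    (hββ : bform β β ≠ 0) (hγγ : bform γ γ ≠ 0)
    (hinvβ : ∀ i, ∀ x : Fin (n + 1) → ℂ,
      MvPolynomial.eval (reflect β x) (p i) = MvPolynomial.eval x (p i))
    (hinvγ : ∀ i, ∀ x : Fin (n + 1) → ℂ,
      MvPolynomial.eval (reflect γ x) (p i) = MvPolynomial.eval x (p i))
    (x : Fin (n + 1) → ℂ) (hxβ : bform β x = 0) (hxγ : bform γ x = 0) :
    (Matrix.of fun i j : Fin n =>
      MvPolynomial.eval x (dirDeriv (αv (k.succAbove j)) (p i))).det = 0 := by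
  let b := Module.Basis.mk hli hsp.ge
  obtain ⟨s, t, hv0, hvk⟩ := exists_combination_ne_zero_of_linearIndependent hβγ (b.coord k)
  set v := s • β + t • γ with hv
  have hvk' : b.repr v k = 0 := hvk
  have hsum : ∑ j : Fin n, b.repr v (k.succAbove j) • αv (k.succAbove j) = v := by
    have h := b.sum_repr v
    rw [Fin.sum_univ_succAbove _ k, hvk', zero_smul, zero_add] at h
    simpa [b] using h
  rw [← Matrix.exists_mulVec_eq_zero_iff]
  refine ⟨fun j => b.repr v (k.succAbove j), fun h0 => hv0 ?_, ?_⟩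
  · rw [← hsum]
    exact Finset.sum_eq_zero fun j _ => by rw [show b.repr v (k.succAbove j) = 0 from
      congrFun h0 j, zero_smul]
  · ext i
    have hd : eval x (dirDeriv v (p i)) = 0 := by
      have h := eval_dirDeriv_sum_smul Finset.univ ![s, t] ![β, γ] x (p i)
      simp only [Fin.sum_univ_two, Matrix.cons_val_zero, Matrix.cons_val_one] at h
      rw [hv, h, eval_dirDeriv_eq_zero_of_reflect_invariant hββ hxβ (hinvβ i),
        eval_dirDeriv_eq_zero_of_reflect_invariant hγγ hxγ (hinvγ i)]
      simp
    rw [← hsum, eval_dirDeriv_sum_smul] at hd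
    simp only [Matrix.mulVec, dotProduct, Matrix.of_apply, Pi.zero_apply]
    rw [← hd]
    exact Finset.sum_congr rfl fun j _ => mul_comm _ _
end

section
/- Let n ≥ 2, let α₁,…,α_n ∈ ℂ^n, let l ≠ m be indices in {1,…,n} with (α_l, α_m) ≠ 0, and let t¹,…,t^{n−1} be polynomials in n variables over ℂ. Suppose there are polynomials Q_{l,i} and Q_{m,i} (i = 1,…,n−1) with ∂_{α_l} tⁱ = L_{α_l}·Q_{l,i} and ∂_{α_m} tⁱ = L_{α_m}·Q_{m,i}, where L_v is the linear polynomial x ↦ (v,x). Suppose further that the determinants J_m and J_l (formed from t¹,…,t^{n−1} and α₁,…,α_n) factor as J_m = L_{α_l}·G_m and J_l = L_{α_m}·G_l for polynomials G_m, G_l. Then G_m(x) = (−1)^{l+m+1}·G_l(x) for every x ∈ ℂ^n with (α_l,x) = 0 and (α_m,x) = 0. -/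
open MvPolynomial

/-- The linear polynomial `x ↦ (v, x)`. -/
noncomputable def linForm {n : ℕ} (v : Fin n → ℂ) : MvPolynomial (Fin n) ℂ :=
  ∑ i, MvPolynomial.C (v i) * MvPolynomial.X i

/-- For vectors `αv 0, …, αv n` and polynomials `t 0, …, t (n-1)` in `n+1` variables, the
determinant `J_k`: the `(n-1)×(n-1)` (here `n × n`) matrix has `(i,j)`-entry `∂_{α_j} tⁱ`,
rows `i : Fin n` and columns `j ∈ {0,…,n} \ {k}` in increasing order via `k.succAbove`. -/
noncomputable def Jdet {n : ℕ} (αv : Fin (n + 1) → (Fin (n + 1) → ℂ))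
    (t : Fin n → MvPolynomial (Fin (n + 1)) ℂ) (k : Fin (n + 1)) :
    MvPolynomial (Fin (n + 1)) ℂ :=
  (Matrix.of fun i j : Fin n => dirDeriv (αv (k.succAbove j)) (t i)).det

/-- The directional derivative as a derivation of the polynomial ring. -/
noncomputable def dirDerivation {n : ℕ} (v : Fin n → ℂ) :
    Derivation ℂ (MvPolynomial (Fin n) ℂ) (MvPolynomial (Fin n) ℂ) :=
  mkDerivation ℂ fun i => C (v i)

lemma dirDeriv_eq_dirDerivation {n : ℕ} (v : Fin n → ℂ) (p : MvPolynomial (Fin n) ℂ) :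
    dirDeriv v p = dirDerivation v p := by
  have h : (∑ i, (C (v i) : MvPolynomial (Fin n) ℂ) • pderiv i) = dirDerivation v := by
    refine derivation_ext fun j => ?_
    rw [← Derivation.coeFnAddMonoidHom_apply, map_sum, Finset.sum_apply]
    simp [Derivation.coeFnAddMonoidHom_apply, dirDerivation, mkDerivation_X, pderiv_X,
      Pi.single_apply]
  rw [← h, ← Derivation.coeFnAddMonoidHom_apply, map_sum, Finset.sum_apply]
  simp [Derivation.coeFnAddMonoidHom_apply, dirDeriv]

lemma dirDerivation_comm {n : ℕ} (u v : Fin n → ℂ) (p : MvPolynomial (Fin n) ℂ) :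
    dirDerivation u (dirDerivation v p) = dirDerivation v (dirDerivation u p) := by
  have h : ⁅dirDerivation u, dirDerivation v⁆ = 0 :=
    derivation_ext fun i => by
      simp [Derivation.commutator_apply, dirDerivation, mkDerivation_X]
  have h' := DFunLike.congr_fun h p
  rw [Derivation.commutator_apply] at h'
  exact sub_eq_zero.mp h'

lemma dirDerivation_linForm {n : ℕ} (u v : Fin n → ℂ) :
    dirDerivation u (linForm v) = C (bform v u) := by
  simp [linForm, bform, dirDerivation, mkDerivation_X, Derivation.leibniz]

lemma bform_comm {n : ℕ} (u v : Fin n → ℂ) : bform u v = bform v u := by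
  simp [bform, mul_comm]

lemma eval_linForm {n : ℕ} (v x : Fin n → ℂ) : eval x (linForm v) = bform v x := by
  simp [linForm, bform]

/-- If `∂_u p = L_u a` and `∂_v p = L_v b` with `(u, v) ≠ 0`, then `a` and `b` agree wherever
both `L_u` and `L_v` vanish. -/
lemma eval_eq_of_dirDeriv_eq_linForm_mul {n : ℕ} {u v : Fin n → ℂ} (huv : bform u v ≠ 0)
    {p a b : MvPolynomial (Fin n) ℂ} (ha : dirDeriv u p = linForm u * a)
    (hb : dirDeriv v p = linForm v * b) {x : Fin n → ℂ} (hu : bform u x = 0)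
    (hv : bform v x = 0) : eval x a = eval x b := by
  rw [dirDeriv_eq_dirDerivation] at ha hb
  have h := congrArg (eval x) (dirDerivation_comm v u p)
  rw [ha, hb] at h
  simp only [Derivation.leibniz, dirDerivation_linForm, smul_eq_mul, map_add, map_mul,
    eval_linForm, hu, hv, eval_C, zero_mul, zero_add, bform_comm v u] at h
  exact mul_right_cancel₀ huv h

/-- Pulling a common factor of column `l` out of the minor omitting column `m ≠ l`. -/
lemma det_minor_eq_mul {R : Type*} [CommRing R] {n : ℕ} (K : Fin n → Fin (n + 1) → R)
    {l m : Fin (n + 1)} (hlm : l ≠ m) (c : R) (q : Fin n → R) (hK : ∀ i, K i l = c * q i) :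
    (Matrix.of fun i j => K i (m.succAbove j)).det =
      c * (Matrix.of fun i j => Function.update (K i) l (q i) (m.succAbove j)).det := by
  obtain ⟨j₀, rfl⟩ := Fin.exists_succAbove_eq hlm
  have h := Matrix.det_mul_row (fun j => if j = j₀ then c else 1)
    (Matrix.of fun i j => Function.update (K i) (m.succAbove j₀) (q i) (m.succAbove j))
  rw [Finset.prod_ite_eq' Finset.univ j₀ fun _ => c, if_pos (Finset.mem_univ _)] at h
  rw [← h]
  congr 1
  ext i j
  by_cases hj : j = j₀
  · simp [hj, hK]
  · simp [hj]

/-- If columns `l ≠ m` of an `n × (n + 1)` matrix coincide, then the minors omitting `m` and `l`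
agree up to sign. -/
lemma det_minor_eq_neg_one_pow_mul {R : Type*} [CommRing R] {n : ℕ}
    (K : Fin n → Fin (n + 1) → R) {l m : Fin (n + 1)} (hlm : l ≠ m) (hK : ∀ i, K i l = K i m) :
    (Matrix.of fun i j => K i (m.succAbove j)).det =
      (-1) ^ ((l : ℕ) + m + 1) * (Matrix.of fun i j => K i (l.succAbove j)).det := by
  let A : Matrix (Fin (n + 1)) (Fin (n + 1)) R :=
    Matrix.of (Fin.cons (fun j => if j = l ∨ j = m then 1 else 0) K)
  have h₀ : A.det = 0 := Matrix.det_zero_of_column_eq hlm fun i => by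
    refine Fin.cases ?_ (fun i => ?_) i <;> simp [A, hK]
  have hs (k : Fin (n + 1)) : A.submatrix Fin.succ k.succAbove =
      Matrix.of fun i j => K i (k.succAbove j) := by
    ext i j
    simp [A]
  rw [Matrix.det_succ_row_zero, Finset.sum_eq_add_of_mem l m (Finset.mem_univ _)
    (Finset.mem_univ _) hlm fun k _ hk => by simp [A, hk.1, hk.2], hs, hs] at h₀
  simp only [A, Matrix.of_apply, Fin.cons_zero, true_or, or_true, if_true, mul_one] at h₀
  have hm : ((-1 : R) ^ (m : ℕ)) * (-1) ^ (m : ℕ) = 1 := by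
    rw [← mul_pow]
    simp
  linear_combination (-1) ^ (m : ℕ) * h₀ - (Matrix.of fun i j => K i (m.succAbove j)).det * hm

/-- The cofactor of `L_{α_l}` in `J_k`, evaluated at a point. -/
lemma eval_cofactor_Jdet {n : ℕ} {αv : Fin (n + 1) → (Fin (n + 1) → ℂ)} {l m : Fin (n + 1)}
    (hlm : l ≠ m) (hl : linForm (αv l) ≠ 0) {t Q : Fin n → MvPolynomial (Fin (n + 1)) ℂ}
    (hQ : ∀ i, dirDeriv (αv l) (t i) = linForm (αv l) * Q i)
    {G : MvPolynomial (Fin (n + 1)) ℂ} (hG : Jdet αv t m = linForm (αv l) * G)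
    (x : Fin (n + 1) → ℂ) :
    eval x G = (Matrix.of fun i j => Function.update
      (fun k => eval x (dirDeriv (αv k) (t i))) l (eval x (Q i)) (m.succAbove j)).det := by
  rw [Jdet, det_minor_eq_mul (fun i k => dirDeriv (αv k) (t i)) hlm _ Q hQ] at hG
  rw [← mul_left_cancel₀ hl hG, RingHom.map_det]
  congr 1
  ext i j
  simp only [RingHom.mapMatrix_apply, Matrix.map_apply, Matrix.of_apply, Function.update_apply]
  split_ifs <;> rfl

/- Here the number of variables of the natural-language statement is `n + 1` (so that the
hypothesis `n ≥ 2` there becomes `1 ≤ n`). The sign `(−1)^{l+m+1}` is unchanged under the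
shift from 1-based to 0-based indexing, since both indices shift by one. -/
theorem stmt16 (n : ℕ) (hn : 1 ≤ n)
    (αv : Fin (n + 1) → (Fin (n + 1) → ℂ))
    (l m : Fin (n + 1)) (hlm : l ≠ m) (hbil : bform (αv l) (αv m) ≠ 0)
    (t : Fin n → MvPolynomial (Fin (n + 1)) ℂ)
    (Ql Qm : Fin n → MvPolynomial (Fin (n + 1)) ℂ)
    (hQl : ∀ i, dirDeriv (αv l) (t i) = linForm (αv l) * Ql i)
    (hQm : ∀ i, dirDeriv (αv m) (t i) = linForm (αv m) * Qm i)
    (Gm Gl : MvPolynomial (Fin (n + 1)) ℂ)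
    (hJm : Jdet αv t m = linForm (αv l) * Gm)
    (hJl : Jdet αv t l = linForm (αv m) * Gl)
    (x : Fin (n + 1) → ℂ) (hxl : bform (αv l) x = 0) (hxm : bform (αv m) x = 0) :
    MvPolynomial.eval x Gm = (-1 : ℂ) ^ ((l : ℕ) + (m : ℕ) + 1) * MvPolynomial.eval x Gl := by
  have hne {u v : Fin (n + 1) → ℂ} (h : bform u v ≠ 0) : linForm u ≠ 0 := fun h0 =>
    h (by rw [← eval_linForm, h0, map_zero])
  have hq (i : Fin n) : eval x (Ql i) = eval x (Qm i) :=
    eval_eq_of_dirDeriv_eq_linForm_mul hbil (hQl i) (hQm i) hxl hxm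
  rw [eval_cofactor_Jdet hlm (hne hbil) hQl hJm x,
    eval_cofactor_Jdet hlm.symm (hne (bform_comm _ _ ▸ hbil)) hQm hJl x]
  let K : Fin n → Fin (n + 1) → ℂ := fun i => Function.update (Function.update
    (fun k => eval x (dirDeriv (αv k) (t i))) l (eval x (Ql i))) m (eval x (Qm i))
  convert det_minor_eq_neg_one_pow_mul K hlm fun i => by simp [K, hlm, hq] using 3
  · ext i j
    simp [K, Fin.succAbove_ne]
  · congr 1
    ext i j
    simp [K, Function.update_comm hlm, Fin.succAbove_ne]
end
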